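/- Every connected graph with more than one end admits a basic cut system. -/

import Mathlib

open Set

universe u

/-- The underlying undirected graph of a digraph given by its edge relation. -/
def UG {V : Type u} (E : V → V → Prop) : SimpleGraph V := SimpleGraph.fromRel E

/-- `E` is a digraph edge relation: irreflexive and antisymmetric. -/
def IsDigraph {V : Type u} (E : V → V → Prop) : Prop :=
  (∀ x, ¬ E x x) ∧ ∀ x y, E x y → ¬ E y x

/-- A ray in a graph: a one-way infinite path. -/
def IsRay {V : Type u} (G : SimpleGraph V) (r : ℕ → V) : Prop :=
  Function.Injective r ∧ ∀ n, G.Adj (r n) (r (n + 1))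

/-- A sequence is eventually in a set. -/
def EventuallyIn {V : Type u} (r : ℕ → V) (C : Set V) : Prop :=
  ∃ N, ∀ n, N ≤ n → r n ∈ C

/-- `C` is a connected component of the subgraph of `G` induced on `W`:
a maximal connected subset of `W`. -/
def IsCompOf {V : Type u} (G : SimpleGraph V) (C W : Set V) : Prop :=
  C.Nonempty ∧ C ⊆ W ∧ (G.induce C).Connected ∧
    ∀ C', C ⊆ C' → C' ⊆ W → (G.induce C').Connected → C' = C

/-- Two rays are equivalent if for every finite vertex set `S` they lie eventually
in the same component of the graph minus `S`. -/
def RayEquiv {V : Type u} (G : SimpleGraph V) (r r' : ℕ → V) : Prop :=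
  ∀ S : Finset V, ∃ C : Set V, IsCompOf G C {v | v ∉ S} ∧
    EventuallyIn r C ∧ EventuallyIn r' C

/-- The graph has more than one end: two inequivalent rays. -/
def MoreThanOneEnd {V : Type u} (G : SimpleGraph V) : Prop :=
  ∃ r r' : ℕ → V, IsRay G r ∧ IsRay G r' ∧ ¬ RayEquiv G r r'

/-- The graph has infinitely many ends: arbitrarily large families of pairwise
inequivalent rays. -/
def InfinitelyManyEnds {V : Type u} (G : SimpleGraph V) : Prop :=
  ∀ n : ℕ, ∃ f : Fin n → (ℕ → V), (∀ i, IsRay G (f i)) ∧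
    ∀ i j, i ≠ j → ¬ RayEquiv G (f i) (f j)

/-- A separation of a graph: a pair of vertex sets covering `V` such that every
edge lies within one side. -/
def IsSeparation {V : Type u} (G : SimpleGraph V) (c : Set V × Set V) : Prop :=
  c.1 ∪ c.2 = univ ∧ ∀ x y, G.Adj x y → (x ∈ c.1 ∧ y ∈ c.1) ∨ (x ∈ c.2 ∧ y ∈ c.2)

/-- The order of a separation: the number of vertices in its separator. -/
noncomputable def sepOrder {V : Type u} (c : Set V × Set V) : ℕ := (c.1 ∩ c.2).ncard

/-- The neighbourhood of a vertex set. -/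
def Nbhd {V : Type u} (G : SimpleGraph V) (A : Set V) : Set V :=
  {v | v ∉ A ∧ ∃ u ∈ A, G.Adj u v}

/-- The separation `(A, ∼)`. -/
def tildeSep {V : Type u} (G : SimpleGraph V) (A : Set V) : Set V × Set V :=
  (A, Aᶜ ∪ Nbhd G Aᶜ)

/-- `S` separates the wings of the separation `c`: every walk from one wing to
the other meets `S`. -/
def SeparatesWings {V : Type u} (G : SimpleGraph V) (c : Set V × Set V) (S : Set V) : Prop :=
  ∀ a ∈ c.1 \ c.2, ∀ b ∈ c.2 \ c.1, ∀ w : G.Walk a b, ∃ v ∈ w.support, v ∈ S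

/-- A separation of finite order with non-empty wings is essential if its first wing is
connected and no proper subset of the separator separates the wings. -/
def IsEssential {V : Type u} (G : SimpleGraph V) (c : Set V × Set V) : Prop :=
  IsSeparation G c ∧ (c.1 ∩ c.2).Finite ∧ (c.1 \ c.2).Nonempty ∧ (c.2 \ c.1).Nonempty ∧
  (G.induce (c.1 \ c.2)).Connected ∧
  ∀ S, S ⊂ c.1 ∩ c.2 → ¬ SeparatesWings G c S

/-- `C` is a wing of some separation in `𝒞`. -/
def IsWingOf {V : Type u} (𝒞 : Set (Set V × Set V)) (C : Set V) : Prop :=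
  ∃ d ∈ 𝒞, C = d.1 \ d.2 ∨ C = d.2 \ d.1

/-- A cut system. -/
def IsCutSystem {V : Type u} (G : SimpleGraph V) (𝒞 : Set (Set V × Set V)) : Prop :=
  𝒞.Nonempty ∧ (∀ c ∈ 𝒞, IsEssential G c) ∧
  (∀ c ∈ 𝒞, ∃ d ∈ 𝒞, d.1 ⊆ c.2) ∧
  (∀ c ∈ 𝒞, ∀ C : Set V, IsCompOf G C (c.2 \ c.1) →
    (∃ d ∈ 𝒞, d.1 \ d.2 ⊆ C) → tildeSep G (C ∪ Nbhd G C) ∈ 𝒞) ∧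
  (∀ c ∈ 𝒞, ∀ c' ∈ 𝒞, ∃ C₁ C₂ : Set V,
    ((IsCompOf G C₁ ((c.1 \ c.2) ∩ (c'.1 \ c'.2)) ∧
      IsCompOf G C₂ ((c.2 \ c.1) ∩ (c'.2 \ c'.1))) ∨
     (IsCompOf G C₁ ((c.2 \ c.1) ∩ (c'.1 \ c'.2)) ∧
      IsCompOf G C₂ ((c.1 \ c.2) ∩ (c'.2 \ c'.1)))) ∧
    IsWingOf 𝒞 C₁ ∧ IsWingOf 𝒞 C₂)

/-- Pick a side of a separation. -/
def pickSide {V : Type u} (c : Set V × Set V) : Bool → Set V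
  | false => c.1
  | true => c.2

/-- Two cuts are nested (with respect to the cut system `𝒞`). -/
def NestedPair {V : Type u} (G : SimpleGraph V) (𝒞 : Set (Set V × Set V))
    (c d : Set V × Set V) : Prop :=
  ∃ i j : Bool,
    ((¬ ∃ C, IsCompOf G C ((tildeSep G (pickSide c i ∩ pickSide d j)).1 \
        (tildeSep G (pickSide c i ∩ pickSide d j)).2) ∧
        tildeSep G (C ∪ Nbhd G C) ∈ 𝒞) ∨
     (¬ ∃ C, IsCompOf G C ((tildeSep G (pickSide c i ∩ pickSide d j)).2 \
        (tildeSep G (pickSide c i ∩ pickSide d j)).1) ∧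
        tildeSep G (C ∪ Nbhd G C) ∈ 𝒞)) ∧
    (c.1 ∩ c.2) ∪ (d.1 ∩ d.2) ⊆ pickSide c (!i) ∩ pickSide d (!j)

/-- A cut system is nested if each two of its cuts are nested. -/
def IsNestedSystem {V : Type u} (G : SimpleGraph V) (𝒞 : Set (Set V × Set V)) : Prop :=
  ∀ c ∈ 𝒞, ∀ d ∈ 𝒞, NestedPair G 𝒞 c d

/-- `S` is a `𝒞`-separator. -/
def IsSeparatorOf {V : Type u} (𝒞 : Set (Set V × Set V)) (S : Set V) : Prop :=
  ∃ c ∈ 𝒞, c.1 ∩ c.2 = S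

/-- A vertex set contains an end: some ray lies in it. -/
def ContainsEnd {V : Type u} (G : SimpleGraph V) (A : Set V) : Prop :=
  ∃ r : ℕ → V, IsRay G r ∧ ∀ n, r n ∈ A

/-- A basic cut system. -/
def IsBasic {V : Type u} (G : SimpleGraph V) (𝒞 : Set (Set V × Set V)) : Prop :=
  IsCutSystem G 𝒞 ∧
  (∀ c ∈ 𝒞, ∀ d ∈ 𝒞, ¬ sepOrder c < sepOrder d) ∧
  IsNestedSystem G 𝒞 ∧
  (∀ φ : G ≃g G, ∀ c ∈ 𝒞, ((⇑φ '' c.1, ⇑φ '' c.2) : Set V × Set V) ∈ 𝒞) ∧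
  (∀ S S' : Set V, IsSeparatorOf 𝒞 S → IsSeparatorOf 𝒞 S' → ∃ φ : G ≃g G, ⇑φ '' S = S') ∧
  (∀ c ∈ 𝒞, ContainsEnd G c.1 ∧ ContainsEnd G c.2 ∧
    ¬ ∃ d : Set V × Set V, IsSeparation G d ∧ (d.1 ∩ d.2).Finite ∧
      (d.1 ∩ d.2).ncard < sepOrder c ∧ ContainsEnd G d.1 ∧ ContainsEnd G d.2)

/-- The defining property of a `𝒞`-block. -/
def BlockProp {V : Type u} (𝒞 : Set (Set V × Set V)) (X : Set V) : Prop :=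
  (∀ c ∈ 𝒞, (X ⊆ c.1 ∨ X ⊆ c.2) ∧ ¬ (X ⊆ c.1 ∧ X ⊆ c.2)) ∧
  ∃ c ∈ 𝒞, X ⊆ c.1 ∧ c.1 ∩ c.2 ⊆ X

/-- A `𝒞`-block: a maximal vertex set with the block property. -/
def IsCBlock {V : Type u} (𝒞 : Set (Set V × Set V)) (X : Set V) : Prop :=
  BlockProp 𝒞 X ∧ ∀ X', X ⊆ X' → BlockProp 𝒞 X' → X' = X

/-- A digraph is C-homogeneous: every isomorphism between finite induced
subdigraphs with connected underlying graphs extends to an automorphism. -/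
def DigraphCHom {V : Type u} (E : V → V → Prop) : Prop :=
  ∀ (X Y : Set V), X.Finite → Y.Finite → ((UG E).induce X).Connected →
  ∀ φ : X ≃ Y, (∀ a b : X, E a.1 b.1 ↔ E (φ a).1 (φ b).1) →
  ∃ ψ : Equiv.Perm V, (∀ x y, E (ψ x) (ψ y) ↔ E x y) ∧ ∀ a : X, ψ a.1 = (φ a).1

/-- A graph is C-homogeneous: every isomorphism between finite connected induced
subgraphs extends to an automorphism. -/
def GraphCHom {V : Type u} (G : SimpleGraph V) : Prop :=
  ∀ (X Y : Set V), X.Finite → Y.Finite → (G.induce X).Connected →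
  ∀ φ : X ≃ Y, (∀ a b : X, G.Adj a.1 b.1 ↔ G.Adj (φ a).1 (φ b).1) →
  ∃ ψ : G ≃g G, ∀ a : X, ψ a.1 = (φ a).1

/-- The digraph contains a triangle: three pairwise adjacent vertices. -/
def HasTriangle {V : Type u} (E : V → V → Prop) : Prop :=
  ∃ x y z : V, (UG E).Adj x y ∧ (UG E).Adj y z ∧ (UG E).Adj x z

/-- An `n`-arc: a directed path `p 0, p 1, …, p n`. -/
def IsArc {V : Type u} (E : V → V → Prop) (n : ℕ) (p : ℕ → V) : Prop :=
  (∀ i j, i ≤ n → j ≤ n → p i = p j → i = j) ∧ ∀ i < n, E (p i) (p (i + 1))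

/-- A digraph is highly-arc-transitive: for every `n`, its automorphism group acts
transitively on `n`-arcs. -/
def HighlyArcTransitive {V : Type u} (E : V → V → Prop) : Prop :=
  ∀ n : ℕ, ∀ p q : ℕ → V, IsArc E n p → IsArc E n q →
  ∃ ψ : Equiv.Perm V, (∀ x y, E (ψ x) (ψ y) ↔ E x y) ∧ ∀ i ≤ n, ψ (p i) = q i

/-- An alternating walk `w 0, …, w n` in a digraph. -/
def IsAltWalk {V : Type u} (E : V → V → Prop) (n : ℕ) (w : ℕ → V) : Prop :=
  (∀ i < n, E (w i) (w (i + 1)) ∨ E (w (i + 1)) (w i)) ∧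
  ∀ i, i + 2 ≤ n → (E (w i) (w (i + 1)) ↔ E (w (i + 2)) (w (i + 1)))

/-- The edge `e` lies on the walk `w 0, …, w n` (in either direction). -/
def EdgeOnWalk {V : Type u} (n : ℕ) (w : ℕ → V) (e : V × V) : Prop :=
  ∃ i < n, (w i = e.1 ∧ w (i + 1) = e.2) ∨ (w i = e.2 ∧ w (i + 1) = e.1)

/-- Two edges are reachable from each other: they lie on a common alternating walk. -/
def Reach {V : Type u} (E : V → V → Prop) (e f : V × V) : Prop :=
  ∃ n w, IsAltWalk E n w ∧ EdgeOnWalk n w e ∧ EdgeOnWalk n w f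

/-- The edge relation of the reachability digraph `Δ_e`. -/
def DeltaRel {V : Type u} (E : V → V → Prop) (e : V × V) : V → V → Prop :=
  fun x y => E x y ∧ Reach E e (x, y)

/-- The underlying undirected graph of the reachability digraph `Δ_e`. -/
def DeltaGraph {V : Type u} (E : V → V → Prop) (e : V × V) : SimpleGraph V :=
  UG (DeltaRel E e)

/-- Tails of edges of `𝒜(e)`. -/
def Tails {V : Type u} (E : V → V → Prop) (e : V × V) : Set V :=
  {x | ∃ y, DeltaRel E e x y}

/-- Heads of edges of `𝒜(e)`. -/
def Heads {V : Type u} (E : V → V → Prop) (e : V × V) : Set V :=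
  {y | ∃ x, DeltaRel E e x y}

/-- The set of descendants of a vertex. -/
def Descendants {V : Type u} (E : V → V → Prop) (x : V) : Set V :=
  {y | ∃ n p, IsArc E n p ∧ p 0 = x ∧ p n = y}

/-- `(X, Y)` is a bipartition of the graph `G`. -/
def IsBipartition {V : Type u} (G : SimpleGraph V) (X Y : Set V) : Prop :=
  X ∪ Y = univ ∧ Disjoint X Y ∧
  ∀ a b, G.Adj a b → (a ∈ X ∧ b ∈ Y) ∨ (a ∈ Y ∧ b ∈ X)

/-- `G` with sides `X`, `Y` is C-homogeneous bipartite: every isomorphism between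
finite connected induced subgraphs preserving the sides extends to a side-preserving
automorphism. -/
def BipCHom {V : Type u} (G : SimpleGraph V) (X Y : Set V) : Prop :=
  ∀ (A B : Set V), A.Finite → B.Finite → (G.induce A).Connected →
  ∀ φ : A ≃ B, (∀ a b : A, G.Adj a.1 b.1 ↔ G.Adj (φ a).1 (φ b).1) →
  (∀ a : A, a.1 ∈ X ↔ (φ a).1 ∈ X) → (∀ a : A, a.1 ∈ Y ↔ (φ a).1 ∈ Y) →
  ∃ ψ : G ≃g G, (∀ v, v ∈ X ↔ ψ v ∈ X) ∧ (∀ v, v ∈ Y ↔ ψ v ∈ Y) ∧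
    ∀ a : A, ψ a.1 = (φ a).1

/-- `G` with sides `X`, `Y` is homogeneous bipartite: every isomorphism between
finite induced subgraphs preserving the sides extends to a side-preserving
automorphism. -/
def BipHom {V : Type u} (G : SimpleGraph V) (X Y : Set V) : Prop :=
  ∀ (A B : Set V), A.Finite → B.Finite →
  ∀ φ : A ≃ B, (∀ a b : A, G.Adj a.1 b.1 ↔ G.Adj (φ a).1 (φ b).1) →
  (∀ a : A, a.1 ∈ X ↔ (φ a).1 ∈ X) → (∀ a : A, a.1 ∈ Y ↔ (φ a).1 ∈ Y) →
  ∃ ψ : G ≃g G, (∀ v, v ∈ X ↔ ψ v ∈ X) ∧ (∀ v, v ∈ Y ↔ ψ v ∈ Y) ∧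
    ∀ a : A, ψ a.1 = (φ a).1

/-- `G` with sides `X`, `Y` is generic bipartite. -/
def GenericBip {V : Type u} (G : SimpleGraph V) (X Y : Set V) : Prop :=
  (∀ U W : Set V, U ⊆ X → W ⊆ X → U.Finite → W.Finite → Disjoint U W →
    ∃ v ∈ Y, (∀ u ∈ U, G.Adj v u) ∧ ∀ w ∈ W, ¬ G.Adj v w) ∧
  (∀ U W : Set V, U ⊆ Y → W ⊆ Y → U.Finite → W.Finite → Disjoint U W →
    ∃ v ∈ X, (∀ u ∈ U, G.Adj v u) ∧ ∀ w ∈ W, ¬ G.Adj v w)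

section BasicCutSystem

variable {V : Type u} {G : SimpleGraph V}

/-! ### Connected sets and components -/

lemma subset_of_induce_connected {K P : Set V} (hK : (G.induce K).Connected)
    (hne : (K ∩ P).Nonempty) (hcl : ∀ x ∈ K, x ∈ P → ∀ y ∈ K, G.Adj x y → y ∈ P) :
    K ⊆ P := by
  obtain ⟨x, hx, hxP⟩ := hne
  have key : ∀ {a b : K}, (G.induce K).Walk a b → a.1 ∈ P → b.1 ∈ P := by
    intro _ _ w
    induction w with
    | nil => exact id
    | cons h _ ih => exact fun ha => ih (hcl _ (Subtype.prop _) ha _ (Subtype.prop _) h)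
  intro y hy
  obtain ⟨w⟩ := hK.preconnected ⟨x, hx⟩ ⟨y, hy⟩
  exact key w hxP

lemma IsCompOf.subset_of_connected {C W K : Set V} (h : IsCompOf G C W)
    (hK : (G.induce K).Connected) (hKW : K ⊆ W) (hne : (K ∩ C).Nonempty) : K ⊆ C := by
  have := h.2.2.2 (C ∪ K) subset_union_left (union_subset h.2.1 hKW)
    (SimpleGraph.induce_union_connected h.2.2.1.preconnected hK.preconnected (by rwa [inter_comm]))
  rw [← this]
  exact subset_union_right

lemma IsCompOf.mem_of_adj {C W : Set V} (h : IsCompOf G C W) {x y : V} (hx : x ∈ C)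
    (hy : y ∈ W) (hxy : G.Adj x y) : y ∈ C := by
  refine h.subset_of_connected (K := {x, y})
    (SimpleGraph.induce_pair_connected_of_adj hxy) ?_ ⟨x, by simp, hx⟩ (by simp)
  rintro z (rfl | rfl)
  exacts [h.2.1 hx, hy]

lemma IsCompOf.eq_of_mem {C D W : Set V} (h : IsCompOf G C W) (h' : IsCompOf G D W) {x : V}
    (hC : x ∈ C) (hD : x ∈ D) : C = D :=
  (h'.subset_of_connected h.2.2.1 h.2.1 ⟨x, hC, hD⟩).antisymm
    (h.subset_of_connected h'.2.2.1 h'.2.1 ⟨x, hD, hC⟩)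

lemma IsCompOf.mono {C W W' : Set V} (h : IsCompOf G C W) (hCW : C ⊆ W') (hW : W' ⊆ W) :
    IsCompOf G C W' :=
  ⟨h.1, hCW, h.2.2.1, fun C' h₁ h₂ h₃ => h.2.2.2 C' h₁ (h₂.trans hW) h₃⟩

lemma exists_isCompOf_mem {W : Set V} {x : V} (hx : x ∈ W) :
    ∃ C, IsCompOf G C W ∧ x ∈ C := by
  let F : Set (Set V) := {K | x ∈ K ∧ K ⊆ W ∧ (G.induce K).Connected}
  have hF : ({x} : Set V) ∈ F :=
    ⟨rfl, by simpa using hx, by simp⟩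
  have hmem : x ∈ ⋃₀ F := ⟨{x}, hF, rfl⟩
  refine ⟨⋃₀ F, ⟨⟨x, hmem⟩, sUnion_subset fun K hK => hK.2.1, ?_, ?_⟩, hmem⟩
  · exact SimpleGraph.induce_sUnion_connected_of_pairwise_not_disjoint ⟨_, hF⟩
      (fun {s} {t} hs ht => ⟨x, hs.1, ht.1⟩) (fun {s} hs => hs.2.2)
  · intro C' h₁ h₂ h₃
    exact (subset_sUnion_of_mem (show C' ∈ F from ⟨h₁ hmem, h₂, h₃⟩)).antisymm h₁

lemma exists_isCompOf_superset {W K : Set V} (hK : (G.induce K).Connected) (hKW : K ⊆ W) :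
    ∃ C, IsCompOf G C W ∧ K ⊆ C := by
  obtain ⟨⟨x, hx⟩⟩ := hK.nonempty
  obtain ⟨C, hC, hxC⟩ := exists_isCompOf_mem (G := G) (hKW hx)
  exact ⟨C, hC, hC.subset_of_connected hK hKW ⟨x, hx, hxC⟩⟩

lemma IsCompOf.nbhd_subset {S C : Set V} (h : IsCompOf G C Sᶜ) : Nbhd G C ⊆ S := by
  rintro v ⟨hv, u, hu, huv⟩
  by_contra hvS
  exact hv (h.mem_of_adj hu hvS huv)

/-- A component of the complement of another component of `G - S` is a component of `G - S`. -/
lemma IsCompOf.of_diff {S C C' : Set V} (h : IsCompOf G C Sᶜ) (h' : IsCompOf G C' (Cᶜ \ S)) :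
    IsCompOf G C' Sᶜ := by
  obtain ⟨K, hK, hCK⟩ := exists_isCompOf_superset (G := G) (W := Sᶜ) h'.2.2.1
    (fun x hx => (h'.2.1 hx).2)
  obtain ⟨x, hx⟩ := h'.1
  have hKC : K ⊆ Cᶜ \ S := fun y hy => ⟨fun hyC =>
    (h'.2.1 hx).1 (hK.eq_of_mem h hy hyC ▸ hCK hx), hK.2.1 hy⟩
  rwa [← h'.2.2.2 K hCK hKC hK.2.2.1]

/-! ### Rays -/

lemma IsRay.tail {r : ℕ → V} (h : IsRay G r) (N : ℕ) : IsRay G fun n => r (N + n) :=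
  ⟨fun a b hab => Nat.add_left_cancel (h.1 hab), fun n => h.2 (N + n)⟩

lemma IsRay.induce_range_connected {r : ℕ → V} (h : IsRay G r) :
    (G.induce (range r)).Connected := by
  rw [SimpleGraph.connected_iff_exists_forall_reachable]
  refine ⟨⟨r 0, 0, rfl⟩, ?_⟩
  rintro ⟨_, n, rfl⟩
  induction n with
  | zero => rfl
  | succ n ih =>
    refine ih.trans (SimpleGraph.Adj.reachable ?_)
    exact h.2 n

lemma IsRay.exists_avoid {r : ℕ → V} (h : IsRay G r) {S : Set V} (hS : S.Finite) :
    ∃ N, ∀ n, r (N + n) ∉ S := by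
  obtain ⟨N, hN⟩ := (hS.preimage h.1.injOn).bddAbove
  refine ⟨N + 1, fun n hn => ?_⟩
  have : N + 1 + n ≤ N := hN hn
  omega

lemma IsRay.exists_isCompOf {r : ℕ → V} (h : IsRay G r) {S : Set V} (hS : S.Finite) :
    ∃ C, IsCompOf G C Sᶜ ∧ ∃ N, ∀ n, r (N + n) ∈ C := by
  obtain ⟨N, hN⟩ := h.exists_avoid hS
  obtain ⟨C, hC, hNC⟩ := exists_isCompOf_superset (G := G) (W := Sᶜ)
    (h.tail N).induce_range_connected (by rintro _ ⟨n, rfl⟩; exact hN n)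
  exact ⟨C, hC, N, fun n => hNC ⟨n, rfl⟩⟩

lemma ContainsEnd.mono {A B : Set V} (h : ContainsEnd G A) (hAB : A ⊆ B) : ContainsEnd G B := by
  obtain ⟨r, hr, hA⟩ := h
  exact ⟨r, hr, fun n => hAB (hA n)⟩

lemma ContainsEnd.diff {A S : Set V} (h : ContainsEnd G A) (hS : S.Finite) :
    ContainsEnd G (A \ S) := by
  obtain ⟨r, hr, hA⟩ := h
  obtain ⟨N, hN⟩ := hr.exists_avoid hS
  exact ⟨_, hr.tail N, fun n => ⟨hA _, hN n⟩⟩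

/-- `C` is a component of `G - S` that contains an end. -/
def IsEndComp (G : SimpleGraph V) (S C : Set V) : Prop :=
  IsCompOf G C Sᶜ ∧ ContainsEnd G C

lemma ContainsEnd.exists_isEndComp {A S : Set V} (h : ContainsEnd G A) (hS : S.Finite) :
    ∃ C, IsEndComp G S C ∧ ContainsEnd G (A ∩ C) := by
  obtain ⟨r, hr, hA⟩ := h
  obtain ⟨C, hC, N, hN⟩ := hr.exists_isCompOf hS
  exact ⟨C, ⟨hC, _, hr.tail N, hN⟩, _, hr.tail N, fun n => ⟨hA _, hN n⟩⟩

lemma ContainsEnd.nonempty {A : Set V} (h : ContainsEnd G A) : A.Nonempty := by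
  obtain ⟨r, -, hA⟩ := h
  exact ⟨r 0, hA 0⟩

lemma IsEndComp.disjoint {S C : Set V} (h : IsEndComp G S C) : Disjoint C S :=
  disjoint_left.2 fun _ hx => h.1.2.1 hx

/-! ### Separators of ends -/

/-- `S` is a finite vertex set separating two ends. -/
def IsEndSep (G : SimpleGraph V) (S : Set V) : Prop :=
  S.Finite ∧ ∃ C D, IsEndComp G S C ∧ IsEndComp G S D ∧ C ≠ D

/-- `S` is a vertex set of minimum size separating two ends. -/
def IsMinEndSep (G : SimpleGraph V) (S : Set V) : Prop :=
  IsEndSep G S ∧ ∀ T, IsEndSep G T → S.ncard ≤ T.ncard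

lemma isEndSep_of_closed {S P Q : Set V} (hS : S.Finite) (hP : ContainsEnd G P)
    (hQ : ContainsEnd G Q) (hPQ : Disjoint P Q)
    (hcl : ∀ x ∈ P, ∀ y, y ∉ S → G.Adj x y → y ∈ P) : IsEndSep G S := by
  obtain ⟨C, hC, hPC⟩ := hP.exists_isEndComp hS
  obtain ⟨D, hD, hQD⟩ := hQ.exists_isEndComp hS
  refine ⟨hS, C, D, hC, hD, ?_⟩
  rintro rfl
  have : C ⊆ P := subset_of_induce_connected hC.1.2.2.1 (by rw [inter_comm]; exact hPC.nonempty)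
    fun x _ hxP y hy hxy => hcl x hxP y (hC.1.2.1 hy) hxy
  obtain ⟨x, hx, hxC⟩ := hQD.nonempty
  exact disjoint_left.1 hPQ (this hxC) hx

lemma IsEndSep.exists_ne {S : Set V} (h : IsEndSep G S) (K : Set V) :
    ∃ C, IsEndComp G S C ∧ C ≠ K := by
  obtain ⟨-, C, D, hC, hD, hne⟩ := h
  by_cases hCK : C = K
  · exact ⟨D, hD, fun h => hne (hCK.trans h.symm)⟩
  · exact ⟨C, hC, hCK⟩

lemma IsEndSep.exists_disjoint {S K : Set V} (h : IsEndSep G S) (hK : IsCompOf G K Sᶜ) :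
    ∃ C, IsEndComp G S C ∧ Disjoint C K := by
  obtain ⟨C, hC, hne⟩ := h.exists_ne K
  exact ⟨C, hC, disjoint_left.2 fun x hx hxK => hne (hC.1.eq_of_mem hK hx hxK)⟩

lemma IsMinEndSep.nbhd_eq {S C : Set V} (h : IsMinEndSep G S) (hC : IsEndComp G S C) :
    Nbhd G C = S := by
  have hsub := hC.1.nbhd_subset
  obtain ⟨D, hD, hDC⟩ := h.1.exists_disjoint hC.1
  refine eq_of_subset_of_ncard_le hsub (h.2 _ ?_) h.1.1
  refine isEndSep_of_closed (h.1.1.subset hsub) hC.2 hD.2 hDC.symm fun x hx y hy hxy => ?_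
  by_contra hyC
  exact hy ⟨hyC, x, hx, hxy⟩

lemma IsMinEndSep.exists_adj {S C : Set V} (h : IsMinEndSep G S) (hC : IsEndComp G S C) {s : V}
    (hs : s ∈ S) : ∃ u ∈ C, G.Adj u s := by
  rw [← h.nbhd_eq hC] at hs
  exact hs.2

/-- Two separators are nested if some end component of the second one avoids the first one. -/
def SepNested (G : SimpleGraph V) (S T : Set V) : Prop :=
  ∃ D, IsEndComp G T D ∧ Disjoint D S

lemma SepNested.exists_isCompOf {S T : Set V} (h : SepNested G S T) (hT : IsMinEndSep G T) :
    ∃ K, IsCompOf G K Sᶜ ∧ T ⊆ K ∪ S := by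
  obtain ⟨D, hD, hDS⟩ := h
  obtain ⟨K, hK, hDK⟩ := exists_isCompOf_superset (G := G) (W := Sᶜ) hD.1.2.2.1
    fun x hx => disjoint_left.1 hDS hx
  refine ⟨K, hK, fun t ht => ?_⟩
  obtain ⟨u, hu, hut⟩ := hT.exists_adj hD ht
  by_cases htS : t ∈ S
  · exact Or.inr htS
  · exact Or.inl (hK.mem_of_adj (hDK hu) htS hut)

lemma SepNested.symm {S T : Set V} (h : SepNested G S T) (hS : IsMinEndSep G S)
    (hT : IsMinEndSep G T) : SepNested G T S := by
  obtain ⟨K, hK, hTK⟩ := h.exists_isCompOf hT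
  obtain ⟨C, hC, hCK⟩ := hS.1.exists_disjoint hK
  refine ⟨C, hC, disjoint_left.2 fun x hx hxT => ?_⟩
  rcases hTK hxT with hxK | hxS
  · exact disjoint_left.1 hCK hx hxK
  · exact hC.1.2.1 hx hxS

/-! ### Finiteness of the set of crossing separators -/

/-- There are only finitely many minimal `x`-`y` separators of a given size. -/
lemma finite_setOf_minimal_separators (x y : V) (k : ℕ) (F : Set V) :
    {T : Set V | T.Finite ∧ T.ncard = k ∧
      (∀ w : G.Walk x y, (∀ v ∈ w.support, v ∉ F) → ∃ v ∈ w.support, v ∈ T) ∧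
      ∀ t ∈ T, ∃ w : G.Walk x y, ∀ v ∈ w.support, v ∉ F ∧ (v ∈ T → v = t)}.Finite := by
  induction k generalizing F with
  | zero =>
    refine (finite_singleton (∅ : Set V)).subset ?_
    rintro T ⟨hfin, hcard, -⟩
    exact (ncard_eq_zero hfin).1 hcard
  | succ k ih =>
    by_cases hw : ∃ w : G.Walk x y, ∀ v ∈ w.support, v ∉ F
    · obtain ⟨w, hw⟩ := hw
      have hfin : (⋃ v ∈ {v | v ∈ w.support}, (fun T => insert v T) '' {T : Set V | T.Finite ∧
          T.ncard = k ∧ (∀ w : G.Walk x y, (∀ u ∈ w.support, u ∉ insert v F) →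
            ∃ u ∈ w.support, u ∈ T) ∧ ∀ t ∈ T, ∃ w : G.Walk x y,
            ∀ u ∈ w.support, u ∉ insert v F ∧ (u ∈ T → u = t)}).Finite :=
        (List.finite_toSet w.support).biUnion fun v _ => (ih (insert v F)).image _
      refine hfin.subset ?_
      rintro T ⟨hT, hcard, hsep, hmin⟩
      obtain ⟨v, hv, hvT⟩ := hsep w hw
      refine mem_biUnion (show v ∈ {v | v ∈ w.support} from hv)
        ⟨T \ {v}, ⟨hT.sdiff, ?_, ?_, ?_⟩, insert_sdiff_self_of_mem hvT⟩
      · rw [ncard_sdiff_singleton_of_mem hvT, hcard]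
        rfl
      · intro w' hw'
        obtain ⟨u, hu, huT⟩ := hsep w' fun u hu huF => hw' u hu (Or.inr huF)
        exact ⟨u, hu, huT, fun h => hw' u hu (Or.inl h)⟩
      · rintro t ⟨htT, htv⟩
        obtain ⟨w', hw'⟩ := hmin t htT
        refine ⟨w', fun u hu => ⟨?_, fun huT => (hw' u hu).2 huT.1⟩⟩
        rintro (rfl | huF)
        · exact htv ((hw' u hu).2 hvT).symm
        · exact (hw' u hu).1 huF
    · refine finite_empty.subset ?_
      rintro T ⟨hT, hcard, -, hmin⟩
      obtain ⟨t, ht⟩ := nonempty_of_ncard_ne_zero (s := T) (by omega)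
      obtain ⟨w, hw'⟩ := hmin t ht
      exact hw ⟨w, fun v hv => (hw' v hv).1⟩

lemma exists_walk_of_induce_connected {C : Set V} (h : (G.induce C).Connected) {x y : V}
    (hx : x ∈ C) (hy : y ∈ C) : ∃ w : G.Walk x y, ∀ v ∈ w.support, v ∈ C := by
  have key : ∀ a b : C, (G.induce C).Walk a b →
      ∃ w : G.Walk a.1 b.1, ∀ v ∈ w.support, v ∈ C := by
    intro a b w
    induction w with
    | nil => exact ⟨.nil, by simp⟩
    | cons hadj _ ih =>
      obtain ⟨w, hw⟩ := ih
      refine ⟨.cons (SimpleGraph.induce_adj.1 hadj) w, fun v hv => ?_⟩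
      rw [SimpleGraph.Walk.support_cons, List.mem_cons] at hv
      rcases hv with rfl | hv
      exacts [Subtype.prop _, hw v hv]
  obtain ⟨w⟩ := h.preconnected ⟨x, hx⟩ ⟨y, hy⟩
  exact key _ _ w

lemma IsCompOf.mem_of_walk {S C : Set V} (h : IsCompOf G C Sᶜ) {x y : V} (w : G.Walk x y)
    (hx : x ∈ C) (hw : ∀ v ∈ w.support, v ∉ S) : y ∈ C := by
  induction w with
  | nil => exact hx
  | cons hadj w ih =>
    refine ih (h.mem_of_adj hx ?_ hadj) fun v hv => hw v (List.mem_cons_of_mem _ hv)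
    exact hw _ (List.mem_cons_of_mem _ w.start_mem_support)

/-- The minimum end separators that are not nested with `S`. -/
def crossingSeps (G : SimpleGraph V) (S : Set V) : Set (Set V) :=
  {T | IsMinEndSep G T ∧ ¬ SepNested G S T}

lemma finite_crossingSeps {S : Set V} (hS : IsMinEndSep G S) : (crossingSeps G S).Finite := by
  have hfin := hS.1.1.biUnion fun x _ => hS.1.1.biUnion fun y _ =>
    finite_setOf_minimal_separators (G := G) x y S.ncard ∅
  refine hfin.subset ?_
  rintro T ⟨hT, hcross⟩
  obtain ⟨C, D, hC, hD, hne⟩ := hT.1.2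
  have meets : ∀ E, IsEndComp G T E → ∃ x ∈ E, x ∈ S := fun E hE => by
    by_contra! h
    exact hcross ⟨E, hE, disjoint_left.2 h⟩
  obtain ⟨x, hxC, hxS⟩ := meets C hC
  obtain ⟨y, hyD, hyS⟩ := meets D hD
  refine mem_biUnion hxS (mem_biUnion hyS
    ⟨hT.1.1, (hT.2 S hS.1).antisymm (hS.2 T hT.1), fun w _ => ?_, fun t ht => ?_⟩)
  · by_contra! hw
    exact hne (hC.1.eq_of_mem hD.1 (hC.1.mem_of_walk w hxC hw) hyD)
  · obtain ⟨u, hu, hut⟩ := hT.exists_adj hC ht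
    obtain ⟨v, hv, hvt⟩ := hT.exists_adj hD ht
    obtain ⟨p, hp⟩ := exists_walk_of_induce_connected hC.1.2.2.1 hxC hu
    obtain ⟨q, hq⟩ := exists_walk_of_induce_connected hD.1.2.2.1 hv hyD
    refine ⟨p.append (.cons hut (.cons hvt.symm q)), fun z hz => ⟨id, fun hzT => ?_⟩⟩
    rw [SimpleGraph.Walk.mem_support_append_iff] at hz
    simp only [SimpleGraph.Walk.support_cons, List.mem_cons] at hz
    rcases hz with hz | rfl | rfl | hz
    · exact absurd hzT (hC.1.2.1 (hp z hz))
    · exact absurd hzT (hC.1.2.1 hu)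
    · rfl
    · exact absurd hzT (hD.1.2.1 (hq z hz))

/-! ### Uncrossing -/

/-- `X` and `Y` partition the vertices outside `S`, with no edge between them. -/
def IsWingPair (G : SimpleGraph V) (S X Y : Set V) : Prop :=
  Disjoint X Y ∧ X ∪ Y = Sᶜ ∧ ∀ x ∈ X, ∀ y ∈ Y, ¬ G.Adj x y

lemma IsWingPair.symm {S X Y : Set V} (h : IsWingPair G S X Y) : IsWingPair G S Y X :=
  ⟨h.1.symm, by rw [union_comm, h.2.1], fun x hx y hy hxy => h.2.2 y hy x hx hxy.symm⟩

lemma IsCompOf.isWingPair {S C : Set V} (h : IsCompOf G C Sᶜ) : IsWingPair G S C (Cᶜ \ S) := by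
  refine ⟨disjoint_left.2 fun x hx hx' => hx'.1 hx, ?_,
    fun x hx y hy hxy => hy.1 (h.mem_of_adj hx hy.2 hxy)⟩
  ext x
  have := @h.2.1 x
  simp only [mem_union, mem_sdiff, mem_compl_iff] at this ⊢
  tauto

lemma IsWingPair.mem_or {S X Y : Set V} (h : IsWingPair G S X Y) (v : V) :
    v ∈ S ∨ v ∈ X ∨ v ∈ Y := by
  by_cases hv : v ∈ S
  · exact Or.inl hv
  · exact Or.inr (h.2.1 ▸ hv : v ∈ X ∪ Y)

lemma IsWingPair.notMem {S X Y : Set V} (h : IsWingPair G S X Y) {v : V} (hv : v ∈ X) :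
    v ∉ S := by
  have : v ∈ X ∪ Y := Or.inl hv
  rwa [h.2.1] at this

lemma IsWingPair.subset_or {S X Y K : Set V} (h : IsWingPair G S X Y)
    (hK : (G.induce K).Connected) (hKS : Disjoint K S) : K ⊆ X ∨ K ⊆ Y := by
  by_cases hne : (K ∩ X).Nonempty
  · refine Or.inl (subset_of_induce_connected hK hne fun x _ hxX y hy hxy => ?_)
    rcases h.mem_or y with hyS | hyX | hyY
    exacts [absurd hyS (disjoint_left.1 hKS hy), hyX, absurd hxy (h.2.2 x hxX y hyY)]
  · refine Or.inr fun y hy => ?_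
    rcases h.mem_or y with hyS | hyX | hyY
    exacts [absurd hyS (disjoint_left.1 hKS hy), absurd ⟨y, hy, hyX⟩ hne, hyY]

lemma IsWingPair.containsEnd_or {S X Y A : Set V} (h : IsWingPair G S X Y) (hS : S.Finite)
    (hA : ContainsEnd G A) : ContainsEnd G (A ∩ X) ∨ ContainsEnd G (A ∩ Y) := by
  obtain ⟨C, hC, hAC⟩ := hA.exists_isEndComp hS
  exact (h.subset_or hC.1.2.2.1 hC.disjoint).imp
    (fun hX => hAC.mono (inter_subset_inter_right A hX))
    fun hY => hAC.mono (inter_subset_inter_right A hY)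

/-- The boundary of the corner `X ∩ X'` of two separators `S` and `T`. -/
def cornerSep (S T X X' : Set V) : Set V :=
  (S ∩ X') ∪ (T ∩ X) ∪ (S ∩ T)

lemma isEndSep_cornerSep {S T X Y X' Y' : Set V} (hS : S.Finite) (hT : T.Finite)
    (h : IsWingPair G S X Y) (h' : IsWingPair G T X' Y') (hX : ContainsEnd G (X ∩ X'))
    (hY : ContainsEnd G (Y ∩ Y')) : IsEndSep G (cornerSep S T X X') := by
  refine isEndSep_of_closed
    (((hS.inter_of_left _).union (hT.inter_of_left _)).union (hS.inter_of_left _)) hX hY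
    (h.1.mono inter_subset_left inter_subset_left) fun x hx y hy hxy => ?_
  have hy₁ := h.mem_or y
  have hy₂ := h'.mem_or y
  have hy₃ : y ∉ Y := fun hyY => h.2.2 x hx.1 y hyY hxy
  have hy₄ : y ∉ Y' := fun hyY => h'.2.2 x hx.2 y hyY hxy
  simp only [cornerSep, mem_union, mem_inter_iff] at hy ⊢
  tauto

lemma cornerSep_union {S T X Y X' Y' : Set V}
    (h : IsWingPair G S X Y) (h' : IsWingPair G T X' Y') :
    cornerSep S T X X' ∪ cornerSep S T Y Y' = S ∪ T := by
  ext v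
  have h₁ := h.mem_or v
  have h₂ := h'.mem_or v
  simp only [cornerSep, mem_union, mem_inter_iff]
  tauto

lemma cornerSep_inter {S T X Y X' Y' : Set V}
    (h : IsWingPair G S X Y) (h' : IsWingPair G T X' Y') :
    cornerSep S T X X' ∩ cornerSep S T Y Y' = S ∩ T := by
  ext v
  have h₁ := fun hv : v ∈ X => disjoint_left.1 h.1 hv
  have h₂ := fun hv : v ∈ X' => disjoint_left.1 h'.1 hv
  have h₃ := @IsWingPair.notMem V G S X Y h v
  have h₄ := @IsWingPair.notMem V G S Y X h.symm v
  have h₅ := @IsWingPair.notMem V G T X' Y' h' v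
  have h₆ := @IsWingPair.notMem V G T Y' X' h'.symm v
  simp only [cornerSep, mem_union, mem_inter_iff]
  tauto

/-- If two opposite corners of minimum end separators contain ends, then the boundaries of both
corners are minimum end separators. -/
lemma isMinEndSep_cornerSep {S T X Y X' Y' : Set V} (hS : IsMinEndSep G S)
    (hT : IsMinEndSep G T) (h : IsWingPair G S X Y) (h' : IsWingPair G T X' Y')
    (hX : ContainsEnd G (X ∩ X')) (hY : ContainsEnd G (Y ∩ Y')) :
    IsMinEndSep G (cornerSep S T X X') := by
  have hU := isEndSep_cornerSep hS.1.1 hT.1.1 h h' hX hY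
  have hW := isEndSep_cornerSep hS.1.1 hT.1.1 h.symm h'.symm hY hX
  have h₁ := ncard_union_add_ncard_inter _ _ hU.1 hW.1
  rw [cornerSep_union h h', cornerSep_inter h h',
    ncard_union_add_ncard_inter _ _ hS.1.1 hT.1.1] at h₁
  have h₂ := hS.2 _ hW
  have h₃ := hS.2 _ hT.1
  have h₄ := hT.2 _ hS.1
  exact ⟨hU, fun R hR => by have := hS.2 R hR; omega⟩

lemma disjoint_cornerSep {S T X Y X' E : Set V} (h : IsWingPair G S X Y) (hE : E ⊆ Y) :
    Disjoint E (cornerSep S T X X') := by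
  refine disjoint_left.2 fun x hx hx' => ?_
  have h₁ := h.symm.notMem (hE hx)
  have h₂ := disjoint_right.1 h.1 (hE hx)
  simp only [cornerSep, mem_union, mem_inter_iff] at hx'
  tauto

lemma disjoint_cornerSep' {S T X X' Y' E : Set V} (h : IsWingPair G T X' Y') (hE : E ⊆ Y') :
    Disjoint E (cornerSep S T X X') := by
  refine disjoint_left.2 fun x hx hx' => ?_
  have h₁ := h.symm.notMem (hE hx)
  have h₂ := disjoint_right.1 h.1 (hE hx)
  simp only [cornerSep, mem_union, mem_inter_iff] at hx'
  tauto

lemma nbhd_subset_of_wing {S X Y E : Set V} (h : IsWingPair G S X Y) (hE : E ⊆ X) :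
    Nbhd G E ⊆ X ∪ S := by
  rintro v ⟨-, u, hu, huv⟩
  rcases h.mem_or v with hv | hv | hv
  exacts [Or.inr hv, Or.inl hv, absurd huv (h.2.2 u (hE hu) v hv)]

/-- A separator nested with `S` is nested with one of any two opposite corner separators. -/
lemma SepNested.cornerSep_or {R S T X Y X' Y' : Set V} (hR : SepNested G S R)
    (h : IsWingPair G S X Y) :
    SepNested G (cornerSep S T X X') R ∨ SepNested G (cornerSep S T Y Y') R := by
  obtain ⟨E, hE, hES⟩ := hR
  rcases h.subset_or hE.1.2.2.1 hES with hEX | hEY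
  · exact Or.inr ⟨E, hE, disjoint_cornerSep h.symm hEX⟩
  · exact Or.inl ⟨E, hE, disjoint_cornerSep h hEY⟩

lemma SepNested.cornerSep_or' {R S T X Y X' Y' : Set V} (hR : SepNested G T R)
    (h' : IsWingPair G T X' Y') :
    SepNested G (cornerSep S T X X') R ∨ SepNested G (cornerSep S T Y Y') R := by
  obtain ⟨E, hE, hET⟩ := hR
  rcases h'.subset_or hE.1.2.2.1 hET with hEX | hEY
  · exact Or.inr ⟨E, hE, disjoint_cornerSep' h'.symm hEX⟩
  · exact Or.inl ⟨E, hE, disjoint_cornerSep' h' hEY⟩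

/-- A separator nested with both `S` and `T` is nested with their corner separators. -/
lemma SepNested.cornerSep {R S T X Y X' Y' : Set V} (hS : IsMinEndSep G S)
    (hT : IsMinEndSep G T) (hR : IsMinEndSep G R)
    (h : IsWingPair G S X Y) (h' : IsWingPair G T X' Y')
    (hX : ContainsEnd G (X ∩ X')) (hY : ContainsEnd G (Y ∩ Y'))
    (hSR : SepNested G S R) (hTR : SepNested G T R) :
    SepNested G (cornerSep S T X X') R := by
  obtain ⟨E, hE, hES⟩ := hSR
  obtain ⟨F, hF, hFT⟩ := hTR
  rcases h.subset_or hE.1.2.2.1 hES with hEX | hEY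
  swap
  · exact ⟨E, hE, disjoint_cornerSep h hEY⟩
  rcases h'.subset_or hF.1.2.2.1 hFT with hFX | hFY
  swap
  · exact ⟨F, hF, disjoint_cornerSep' h' hFY⟩
  have hU := isMinEndSep_cornerSep hS hT h h' hX hY
  refine SepNested.symm ?_ hR hU
  obtain ⟨D, hD, hYD⟩ := hY.exists_isEndComp hU.1.1
  refine ⟨D, hD, disjoint_left.2 fun v hvD hvR => ?_⟩
  have h₁ : v ∈ X ∪ S := nbhd_subset_of_wing h hEX (by rwa [hR.nbhd_eq hE])
  have h₂ : v ∈ X' ∪ T := nbhd_subset_of_wing h' hFX (by rwa [hR.nbhd_eq hF])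
  have h₃ := hD.1.2.1 hvD
  have hvXX : v ∈ X ∩ X' := by
    simp only [_root_.cornerSep, mem_union, mem_inter_iff, mem_compl_iff] at h₁ h₂ h₃ ⊢
    tauto
  have hDX : D ⊆ X ∩ X' := by
    refine subset_of_induce_connected hD.1.2.2.1 ⟨v, hvD, hvXX⟩ fun x _ hx y hyD hxy => ?_
    have hy := hD.1.2.1 hyD
    have hy₁ := h.mem_or y
    have hy₂ := h'.mem_or y
    have hy₃ : y ∉ Y := fun hyY => h.2.2 x hx.1 y hyY hxy
    have hy₄ : y ∉ Y' := fun hyY => h'.2.2 x hx.2 y hyY hxy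
    simp only [_root_.cornerSep, mem_union, mem_inter_iff, mem_compl_iff] at hy ⊢
    tauto
  obtain ⟨y, hy, hyD⟩ := hYD.nonempty
  exact disjoint_left.1 h.1 (hDX hyD).1 hy.1

lemma sepNested_cornerSep_self {S T X Y X' Y' : Set V} (hS : IsMinEndSep G S)
    (hT : IsMinEndSep G T) (h : IsWingPair G S X Y) (h' : IsWingPair G T X' Y')
    (hX : ContainsEnd G (X ∩ X')) (hY : ContainsEnd G (Y ∩ Y')) :
    SepNested G (cornerSep S T X X') S := by
  have hU := isMinEndSep_cornerSep hS hT h h' hX hY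
  obtain ⟨C, hC, hYC⟩ := hY.exists_isEndComp hS.1.1
  obtain ⟨y, hy, hyC⟩ := hYC.nonempty
  refine ⟨C, hC, disjoint_cornerSep h ?_⟩
  rcases h.subset_or hC.1.2.2.1 hC.disjoint with hCX | hCY
  · exact absurd hy.1 (disjoint_left.1 h.1 (hCX hyC))
  · exact hCY

lemma ncard_crossingSeps_cornerSep {S T X Y X' Y' : Set V} (hS : IsMinEndSep G S)
    (hT : IsMinEndSep G T) (h : IsWingPair G S X Y) (h' : IsWingPair G T X' Y')
    (hX : ContainsEnd G (X ∩ X')) (hY : ContainsEnd G (Y ∩ Y')) (hST : ¬ SepNested G T S) :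
    (crossingSeps G (cornerSep S T X X')).ncard + (crossingSeps G (cornerSep S T Y Y')).ncard <
      (crossingSeps G S).ncard + (crossingSeps G T).ncard := by
  have hU := isMinEndSep_cornerSep hS hT h h' hX hY
  have hW := isMinEndSep_cornerSep hS hT h.symm h'.symm hY hX
  have fS := finite_crossingSeps hS
  have fT := finite_crossingSeps hT
  rw [← ncard_union_add_ncard_inter _ _ (finite_crossingSeps hU) (finite_crossingSeps hW),
    ← ncard_union_add_ncard_inter _ _ fS fT]
  refine add_lt_add_of_lt_of_le (ncard_lt_ncard ?_ (fS.union fT))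
    (ncard_le_ncard ?_ (fS.inter_of_left _))
  · refine (ssubset_iff_of_subset ?_).2 ⟨S, Or.inr ⟨hS, hST⟩, ?_⟩
    · rintro R (⟨hR, hRU⟩ | ⟨hR, hRW⟩)
      · by_contra hcon
        simp only [crossingSeps, mem_union, mem_ofPred_eq, hR, true_and, not_or, not_not] at hcon
        exact hRU (SepNested.cornerSep hS hT hR h h' hX hY hcon.1 hcon.2)
      · by_contra hcon
        simp only [crossingSeps, mem_union, mem_ofPred_eq, hR, true_and, not_or, not_not] at hcon
        exact hRW (SepNested.cornerSep hS hT hR h.symm h'.symm hY hX hcon.1 hcon.2)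
    · rintro (hSU | hSW)
      · exact hSU.2 (sepNested_cornerSep_self hS hT h h' hX hY)
      · exact hSW.2 (sepNested_cornerSep_self hS hT h.symm h'.symm hY hX)
  · rintro R ⟨⟨hR, hRU⟩, -, hRW⟩
    refine ⟨⟨hR, fun hRS => ?_⟩, hR, fun hRT => ?_⟩
    · exact (hRS.cornerSep_or h).elim hRU hRW
    · exact (hRT.cornerSep_or' h').elim hRU hRW

/-- A minimum end separator that crosses as few others as possible. -/
def IsOptimalEndSep (G : SimpleGraph V) (S : Set V) : Prop :=
  IsMinEndSep G S ∧
    ∀ T, IsMinEndSep G T → (crossingSeps G S).ncard ≤ (crossingSeps G T).ncard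

lemma IsOptimalEndSep.sepNested {S T : Set V} (hS : IsOptimalEndSep G S)
    (hT : IsOptimalEndSep G T) : SepNested G T S := by
  by_contra hST
  have key : ∀ {X Y X' Y' : Set V}, IsWingPair G S X Y → IsWingPair G T X' Y' →
      ContainsEnd G (X ∩ X') → ContainsEnd G (Y ∩ Y') → False := fun h h' hX hY => by
    have h₁ := ncard_crossingSeps_cornerSep hS.1 hT.1 h h' hX hY hST
    have h₂ := hS.2 _ (isMinEndSep_cornerSep hS.1 hT.1 h h' hX hY)
    have h₃ := hT.2 _ (isMinEndSep_cornerSep hS.1 hT.1 h.symm h'.symm hY hX)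
    omega
  have wings : ∀ {R : Set V}, IsMinEndSep G R → ∃ X Y, IsWingPair G R X Y ∧
      ContainsEnd G X ∧ ContainsEnd G Y := fun {R} hR => by
    obtain ⟨-, C, D, hC, hD, hne⟩ := hR.1
    refine ⟨C, _, hC.1.isWingPair, hC.2, hD.2.mono fun x hx => ⟨fun hxC => ?_, hD.1.2.1 hx⟩⟩
    exact hne (hC.1.eq_of_mem hD.1 hxC hx)
  obtain ⟨X, Y, h, hX, hY⟩ := wings hS.1
  obtain ⟨X', Y', h', hX', hY'⟩ := wings hT.1
  have h₁ := h'.containsEnd_or hT.1.1.1 hX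
  have h₂ := h'.containsEnd_or hT.1.1.1 hY
  have h₃ := h.containsEnd_or hS.1.1.1 hX'
  have h₄ := h.containsEnd_or hS.1.1.1 hY'
  rw [inter_comm X' X, inter_comm X' Y] at h₃
  rw [inter_comm Y' X, inter_comm Y' Y] at h₄
  have k₁ := fun p q => key h h' p q
  have k₂ := fun p q => key h h'.symm p q
  tauto

/-! ### Invariance under automorphisms -/

lemma symm_image_image (φ : G ≃g G) (A : Set V) : φ.symm '' (φ '' A) = A := by
  rw [← image_comp, show (⇑φ.symm ∘ ⇑φ) = id from funext φ.symm_apply_apply, image_id]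

lemma image_symm_image (φ : G ≃g G) (A : Set V) : φ '' (φ.symm '' A) = A :=
  symm_image_image φ.symm A

lemma induce_image_connected (φ : G ≃g G) {C : Set V} (h : (G.induce C).Connected) :
    (G.induce (φ '' C)).Connected := by
  let f : G.induce C →g G.induce (φ '' C) :=
    { toFun := fun x => ⟨φ x, mem_image_of_mem _ x.2⟩
      map_rel' := fun {a b} hab => φ.map_adj_iff.2 hab }
  refine h.map f ?_
  rintro ⟨_, x, hx, rfl⟩
  exact ⟨⟨x, hx⟩, rfl⟩

lemma IsCompOf.image (φ : G ≃g G) {C W : Set V} (h : IsCompOf G C W) :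
    IsCompOf G (φ '' C) (φ '' W) := by
  refine ⟨h.1.image _, image_mono h.2.1, induce_image_connected φ h.2.2.1,
    fun C' h₁ h₂ h₃ => ?_⟩
  have := h.2.2.2 (φ.symm '' C') ?_ ?_ (induce_image_connected φ.symm h₃)
  · rw [← this, image_symm_image]
  · simpa only [symm_image_image] using image_mono (f := φ.symm) h₁
  · simpa only [symm_image_image] using image_mono (f := φ.symm) h₂

lemma ContainsEnd.image (φ : G ≃g G) {A : Set V} (h : ContainsEnd G A) :
    ContainsEnd G (φ '' A) := by
  obtain ⟨r, hr, hA⟩ := h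
  exact ⟨fun n => φ (r n), ⟨fun a b hab => hr.1 (φ.injective hab),
    fun n => φ.map_adj_iff.2 (hr.2 n)⟩, fun n => mem_image_of_mem _ (hA n)⟩

lemma IsEndComp.image (φ : G ≃g G) {S C : Set V} (h : IsEndComp G S C) :
    IsEndComp G (φ '' S) (φ '' C) :=
  ⟨by simpa only [image_compl_eq φ.bijective] using h.1.image φ, h.2.image φ⟩

lemma IsEndSep.image (φ : G ≃g G) {S : Set V} (h : IsEndSep G S) : IsEndSep G (φ '' S) := by
  obtain ⟨hS, C, D, hC, hD, hne⟩ := h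
  exact ⟨hS.image _, _, _, hC.image φ, hD.image φ, fun h => hne (φ.injective.image_injective h)⟩

lemma IsMinEndSep.image (φ : G ≃g G) {S : Set V} (h : IsMinEndSep G S) :
    IsMinEndSep G (φ '' S) :=
  ⟨h.1.image φ, fun T hT => (ncard_image_of_injective S φ.injective).trans_le (h.2 T hT)⟩

lemma SepNested.image (φ : G ≃g G) {S T : Set V} (h : SepNested G S T) :
    SepNested G (φ '' S) (φ '' T) := by
  obtain ⟨D, hD, hDS⟩ := h
  exact ⟨_, hD.image φ, (disjoint_image_iff φ.injective).2 hDS⟩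

lemma IsOptimalEndSep.image (φ : G ≃g G) {S : Set V} (h : IsOptimalEndSep G S) :
    IsOptimalEndSep G (φ '' S) := by
  refine ⟨h.1.image φ, fun T hT => le_trans ?_ (h.2 T hT)⟩
  have hfin := finite_crossingSeps h.1
  refine le_trans (ncard_le_ncard ?_ (hfin.image (Set.image φ))) (ncard_image_le hfin)
  rintro R ⟨hR, hRS⟩
  refine ⟨φ.symm '' R, ⟨hR.image φ.symm, fun hcon => hRS ?_⟩, image_symm_image φ R⟩
  simpa only [image_symm_image] using hcon.image φ

/-! ### The cuts of a family of separators -/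

/-- The cuts `(C ∪ S, V ∖ C)` for `S ∈ 𝓕` and `C` an end component of `G - S`. -/
def cutsOf (G : SimpleGraph V) (𝓕 : Set (Set V)) : Set (Set V × Set V) :=
  {c | ∃ S ∈ 𝓕, ∃ C, IsEndComp G S C ∧ c = (C ∪ S, Cᶜ)}

lemma IsEndComp.inter_eq {S C : Set V} (h : IsEndComp G S C) : (C ∪ S) ∩ Cᶜ = S := by
  ext x
  have := @h.1.2.1 x
  simp only [mem_union, mem_inter_iff, mem_compl_iff] at this ⊢
  tauto

lemma union_sdiff_compl (S C : Set V) : (C ∪ S) \ Cᶜ = C := by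
  ext x
  simp only [mem_union, mem_sdiff, mem_compl_iff]
  tauto

lemma compl_sdiff_union (S C : Set V) : Cᶜ \ (C ∪ S) = Cᶜ \ S := by
  ext x
  simp only [mem_union, mem_sdiff, mem_compl_iff]
  tauto

lemma IsMinEndSep.tildeSep_eq {S C : Set V} (h : IsMinEndSep G S) (hC : IsEndComp G S C) :
    tildeSep G (C ∪ Nbhd G C) = (C ∪ S, Cᶜ) := by
  rw [h.nbhd_eq hC, tildeSep]
  refine Prod.ext rfl (Subset.antisymm ?_ fun x hx => ?_)
  · rintro x (hx | ⟨hx, u, hu, hux⟩) hxC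
    · exact hx (Or.inl hxC)
    · exact hu (Or.inl (hC.1.mem_of_adj hxC (fun huS => hu (Or.inr huS)) hux.symm))
  · by_cases hxS : x ∈ S
    · obtain ⟨D, hD, hDC⟩ := h.1.exists_disjoint hC.1
      obtain ⟨u, hu, hux⟩ := h.exists_adj hD hxS
      refine Or.inr ⟨fun h => h (Or.inr hxS), u, ?_, hux⟩
      rintro (huC | huS)
      exacts [disjoint_left.1 hDC hu huC, hD.1.2.1 hu huS]
    · exact Or.inl fun h => h.elim hx hxS

lemma IsSeparation.isEndSep {d : Set V × Set V} (hd : IsSeparation G d)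
    (hfin : (d.1 ∩ d.2).Finite) (h₁ : ContainsEnd G d.1) (h₂ : ContainsEnd G d.2) :
    IsEndSep G (d.1 ∩ d.2) := by
  refine isEndSep_of_closed hfin (h₁.diff hfin) (h₂.diff hfin)
    (disjoint_left.2 fun x hx hx' => hx.2 ⟨hx.1, hx'.1⟩) fun x hx y hy hxy => ⟨?_, hy⟩
  rcases hd.2 x y hxy with h | h
  exacts [h.2, absurd ⟨hx.1, h.1⟩ hx.2]

lemma IsMinEndSep.isEssential {S C : Set V} (h : IsMinEndSep G S) (hC : IsEndComp G S C) :
    IsEssential G (C ∪ S, Cᶜ) := by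
  obtain ⟨D, hD, hDC⟩ := h.1.exists_disjoint hC.1
  have hD' : D ⊆ Cᶜ \ S := fun x hx => ⟨disjoint_left.1 hDC hx, hD.1.2.1 hx⟩
  refine ⟨⟨?_, fun x y hxy => ?_⟩, ?_, ?_, ?_, ?_, fun S' hS' hsep => ?_⟩
  · ext x
    simp only [mem_union, mem_compl_iff, mem_univ, iff_true]
    tauto
  · have h₁ := fun hx hy => hC.1.mem_of_adj (x := x) (y := y) hx hy hxy
    have h₂ := fun hy hx => hC.1.mem_of_adj (x := y) (y := x) hy hx hxy.symm
    simp only [mem_union, mem_compl_iff] at h₁ h₂ ⊢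
    tauto
  · simpa only [hC.inter_eq] using h.1.1
  · simpa only [union_sdiff_compl] using hC.1.1
  · simpa only [compl_sdiff_union] using hD.1.1.mono hD'
  · change (G.induce ((C ∪ S) \ Cᶜ)).Connected
    rw [union_sdiff_compl]
    exact hC.1.2.2.1
  · simp only [hC.inter_eq] at hS'
    obtain ⟨s, hs, hsS'⟩ := exists_of_ssubset hS'
    obtain ⟨a, ha, has⟩ := h.exists_adj hC hs
    obtain ⟨b, hb, hbs⟩ := h.exists_adj hD hs
    obtain ⟨v, hv, hvS'⟩ := hsep a (by simpa only [union_sdiff_compl] using ha) b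
      (by simpa only [compl_sdiff_union] using hD' hb) (.cons has (.cons hbs.symm .nil))
    simp only [SimpleGraph.Walk.support_cons, SimpleGraph.Walk.support_nil, List.mem_cons,
      List.not_mem_nil, or_false] at hv
    rcases hv with rfl | rfl | rfl
    exacts [hC.1.2.1 ha (hS'.1 hvS'), hsS' hvS', hD.1.2.1 hb (hS'.1 hvS')]

/-- If `S` and `T` are nested, then some side of any cut at `S` avoids `T`. -/
lemma SepNested.exists_side {S T C : Set V} (hST : SepNested G S T) (hS : IsMinEndSep G S)
    (hT : IsMinEndSep G T) (hC : IsEndComp G S C) :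
    ∃ i X Y, IsWingPair G S X Y ∧ ContainsEnd G X ∧ T ⊆ Y ∪ S ∧
      pickSide (C ∪ S, Cᶜ) i = X ∪ S ∧ pickSide (C ∪ S, Cᶜ) (!i) = Y ∪ S ∧
      pickSide ((C ∪ S) \ Cᶜ, Cᶜ \ (C ∪ S)) i = X ∧
      pickSide ((C ∪ S) \ Cᶜ, Cᶜ \ (C ∪ S)) (!i) = Y := by
  have hCS : Cᶜ = Cᶜ \ S ∪ S := by
    rw [sdiff_union_self]
    exact (union_eq_self_of_subset_right fun x hx hxC => hC.1.2.1 hxC hx).symm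
  have hw := hC.1.isWingPair
  obtain ⟨E, hE, hES⟩ := hST
  rcases hw.subset_or hE.1.2.2.1 hES with hEC | hEC
  · obtain ⟨D, hD, hDC⟩ := hS.1.exists_disjoint hC.1
    exact ⟨true, _, _, hw.symm,
      hD.2.mono fun x hx => ⟨disjoint_left.1 hDC hx, hD.1.2.1 hx⟩,
      hT.nbhd_eq hE ▸ nbhd_subset_of_wing hw hEC, hCS, rfl,
      compl_sdiff_union S C, union_sdiff_compl S C⟩
  · exact ⟨false, _, _, hw, hC.2, hT.nbhd_eq hE ▸ nbhd_subset_of_wing hw.symm hEC, rfl, hCS,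
      union_sdiff_compl S C, compl_sdiff_union S C⟩

/-- A corner without links contains no wing of a cut at a minimum end separator. -/
lemma false_of_isCompOf_corner {S T R X Y X' Y' C D : Set V} (hS : IsMinEndSep G S)
    (hT : IsMinEndSep G T) (hne : S ≠ T) (h : IsWingPair G S X Y) (h' : IsWingPair G T X' Y')
    (hTY : T ⊆ Y ∪ S) (hSY : S ⊆ Y' ∪ T) (hR : IsMinEndSep G R) (hD : IsEndComp G R D)
    (hC : IsCompOf G C ((tildeSep G ((X ∪ S) ∩ (X' ∪ T))).1 \
      (tildeSep G ((X ∪ S) ∩ (X' ∪ T))).2))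
    (heq : tildeSep G (C ∪ Nbhd G C) = (D ∪ R, Dᶜ)) : False := by
  have hRC : R ⊆ Nbhd G C := by
    intro v hv
    have h₁ : v ∈ C ∪ Nbhd G C := by
      rw [show C ∪ Nbhd G C = D ∪ R from congrArg Prod.fst heq]
      exact Or.inr hv
    have h₂ : v ∈ (C ∪ Nbhd G C)ᶜ ∪ Nbhd G (C ∪ Nbhd G C)ᶜ := by
      rw [show (C ∪ Nbhd G C)ᶜ ∪ Nbhd G (C ∪ Nbhd G C)ᶜ = Dᶜ from congrArg Prod.snd heq]
      exact fun hvD => hD.1.2.1 hvD hv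
    rcases h₂ with h₂ | ⟨-, u, hu, huv⟩
    · exact absurd h₁ h₂
    · refine h₁.resolve_left fun hvC => hu ?_
      by_cases huC : u ∈ C
      exacts [Or.inl huC, Or.inr ⟨huC, v, hvC, huv.symm⟩]
  have hCST : Nbhd G C ⊆ S ∩ T := by
    rintro v ⟨hv, u, hu, huv⟩
    obtain ⟨huM, huM'⟩ := hC.2.1 hu
    have hvM : v ∈ (X ∪ S) ∩ (X' ∪ T) := by
      by_contra hvM
      exact huM' (Or.inr ⟨fun h => h huM, v, hvM, huv.symm⟩)
    have hvM' : v ∈ Nbhd G ((X ∪ S) ∩ (X' ∪ T))ᶜ := by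
      by_contra hcon
      exact hv (hC.mem_of_adj hu ⟨hvM, fun h => h.elim (fun h => h hvM) hcon⟩ huv)
    obtain ⟨-, w, hw, hwv⟩ := hvM'
    rw [compl_inter] at hw
    rcases hw with hw | hw
    · have hwY := (h.mem_or w).resolve_left fun hwS => hw (Or.inr hwS)
      have hvS := hvM.1.resolve_left fun hvX =>
        h.2.2 v hvX w (hwY.resolve_left fun hwX => hw (Or.inl hwX)) hwv.symm
      refine ⟨hvS, hvM.2.resolve_left fun hvX' => ?_⟩
      exact (hSY hvS).elim (disjoint_left.1 h'.1 hvX') (h'.notMem hvX')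
    · have hwY := (h'.mem_or w).resolve_left fun hwT => hw (Or.inr hwT)
      have hvT := hvM.2.resolve_left fun hvX =>
        h'.2.2 v hvX w (hwY.resolve_left fun hwX => hw (Or.inl hwX)) hwv.symm
      refine ⟨hvM.1.resolve_left fun hvX => ?_, hvT⟩
      exact (hTY hvT).elim (disjoint_left.1 h.1 hvX) (h.notMem hvX)
  have h₁ := eq_of_subset_of_ncard_le (fun v hv => (hCST (hRC hv)).1) (hS.2 _ hR.1) hS.1.1
  have h₂ := eq_of_subset_of_ncard_le (fun v hv => (hCST (hRC hv)).2) (hT.2 _ hR.1) hT.1.1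
  exact hne (h₁.symm.trans h₂)

/-- A family of pairwise nested minimum end separators. -/
def IsNestedFamily (G : SimpleGraph V) (𝓕 : Set (Set V)) : Prop :=
  (∀ S ∈ 𝓕, IsMinEndSep G S) ∧ ∀ S ∈ 𝓕, ∀ T ∈ 𝓕, SepNested G S T

lemma IsMinEndSep.tildeSep_self_empty {S C D : Set V} (h : IsMinEndSep G S)
    (hC : IsEndComp G S C) (hD : D ⊆ (tildeSep G S).1 \ (tildeSep G S).2) : ¬ D.Nonempty := by
  rintro ⟨s, hsD⟩
  obtain ⟨hs, hs'⟩ := hD hsD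
  obtain ⟨u, hu, hus⟩ := h.exists_adj hC hs
  exact hs' (Or.inr ⟨fun h => h hs, u, hC.1.2.1 hu, hus⟩)

lemma isNestedSystem_cutsOf {𝓕 : Set (Set V)} (h𝓕 : IsNestedFamily G 𝓕) :
    IsNestedSystem G (cutsOf G 𝓕) := by
  rintro _ ⟨S, hSF, C, hC, rfl⟩ _ ⟨T, hTF, D, hD, rfl⟩
  have hS := h𝓕.1 S hSF
  have hT := h𝓕.1 T hTF
  by_cases hST : S = T
  · subst hST
    by_cases hCD : C = D
    · subst hCD
      refine ⟨false, true, Or.inl ?_, ?_⟩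
      · rintro ⟨E, hE, -⟩
        simp only [pickSide, hC.inter_eq] at hE
        exact hS.tildeSep_self_empty hC hE.2.1 hE.1
      · simp only [pickSide, hC.inter_eq, Bool.not_true, Bool.not_false, union_self]
        rw [inter_comm, hC.inter_eq]
    · have hdisj : Disjoint C D :=
        disjoint_left.2 fun x hx hxD => hCD (hC.1.eq_of_mem hD.1 hx hxD)
      refine ⟨false, false, Or.inl ?_, ?_⟩
      · rintro ⟨E, hE, -⟩
        have hinter : (C ∪ S) ∩ (D ∪ S) = S := by
          rw [← inter_union_distrib_right, hdisj.inter_eq, empty_union]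
        simp only [pickSide, hinter] at hE
        exact hS.tildeSep_self_empty hC hE.2.1 hE.1
      · simp only [pickSide, hC.inter_eq, hD.inter_eq, Bool.not_false, union_self]
        exact fun x hx => ⟨fun h => hC.1.2.1 h hx, fun h => hD.1.2.1 h hx⟩
  · obtain ⟨i, X, Y, h, -, hTY, hi, hi', -⟩ := (h𝓕.2 S hSF T hTF).exists_side hS hT hC
    obtain ⟨j, X', Y', h', -, hSY, hj, hj', -⟩ := (h𝓕.2 T hTF S hSF).exists_side hT hS hD
    refine ⟨i, j, Or.inl ?_, ?_⟩
    · rintro ⟨E, hE, R, hRF, F, hF, heq⟩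
      rw [hi, hj] at hE
      exact false_of_isCompOf_corner hS hT hST h h' hTY hSY (h𝓕.1 R hRF) hF hE heq
    · rw [hi', hj', hC.inter_eq, hD.inter_eq]
      exact union_subset (subset_inter subset_union_right hSY)
        (subset_inter hTY subset_union_right)

/-- If the corner `X ∩ X'` has no links, then `X` contains an end component within `Y'`. -/
lemma exists_isEndComp_corner {S T X Y X' Y' : Set V} (hS : IsMinEndSep G S)
    (hT : IsMinEndSep G T) (hne : S ≠ T) (h : IsWingPair G S X Y) (h' : IsWingPair G T X' Y')
    (hTY : T ⊆ Y ∪ S) (hSY : S ⊆ Y' ∪ T) (hX : ContainsEnd G X) :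
    ∃ E, IsEndComp G S E ∧ IsCompOf G E (X ∩ Y') := by
  obtain ⟨E, hE, hXE⟩ := hX.exists_isEndComp hS.1.1
  obtain ⟨x, hxX, hxE⟩ := hXE.nonempty
  have hEX : E ⊆ X := (h.subset_or hE.1.2.2.1 hE.disjoint).resolve_right
    fun hEY => disjoint_left.1 h.1 hxX (hEY hxE)
  have hET : Disjoint E T := disjoint_left.2 fun v hv hvT => (hTY hvT).elim
    (disjoint_left.1 h.1 (hEX hv)) (hE.1.2.1 hv)
  refine ⟨E, hE, ?_⟩
  rcases h'.subset_or hE.1.2.2.1 hET with hEX' | hEY'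
  · exfalso
    obtain ⟨E', hE', hEE'⟩ := exists_isCompOf_superset (G := G) (W := Tᶜ) hE.1.2.2.1
      fun v hv => disjoint_left.1 hET hv
    have hE'X' : E' ⊆ X' := (h'.subset_or hE'.2.2.1
      (disjoint_left.2 fun v hv => hE'.2.1 hv)).resolve_right
      fun hEY => disjoint_left.1 h'.1 (hEX' hxE) (hEY (hEE' hxE))
    have hE'S : E' ⊆ Sᶜ := fun v hv hvS => (hSY hvS).elim
      (disjoint_left.1 h'.1 (hE'X' hv)) (hE'.2.1 hv)
    have heq := hE.1.2.2.2 E' hEE' hE'S hE'.2.2.1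
    subst heq
    exact hne ((hS.nbhd_eq hE).symm.trans (hT.nbhd_eq ⟨hE', hE.2⟩))
  · exact hE.1.mono (subset_inter hEX hEY') fun v hv => h.notMem hv.1

lemma isWingOf_cutsOf {𝓕 : Set (Set V)} {S C : Set V} (hS : S ∈ 𝓕) (hC : IsEndComp G S C) :
    IsWingOf (cutsOf G 𝓕) C :=
  ⟨_, ⟨S, hS, C, hC, rfl⟩, Or.inl (union_sdiff_compl S C).symm⟩

lemma exists_opposite_wings {𝓕 : Set (Set V)} (h𝓕 : IsNestedFamily G 𝓕) {c c' : Set V × Set V}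
    (hc : c ∈ cutsOf G 𝓕) (hc' : c' ∈ cutsOf G 𝓕) :
    ∃ C₁ C₂ : Set V,
      ((IsCompOf G C₁ ((c.1 \ c.2) ∩ (c'.1 \ c'.2)) ∧
        IsCompOf G C₂ ((c.2 \ c.1) ∩ (c'.2 \ c'.1))) ∨
       (IsCompOf G C₁ ((c.2 \ c.1) ∩ (c'.1 \ c'.2)) ∧
        IsCompOf G C₂ ((c.1 \ c.2) ∩ (c'.2 \ c'.1)))) ∧
      IsWingOf (cutsOf G 𝓕) C₁ ∧ IsWingOf (cutsOf G 𝓕) C₂ := by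
  obtain ⟨S, hSF, C, hC, rfl⟩ := hc
  obtain ⟨T, hTF, D, hD, rfl⟩ := hc'
  have hS := h𝓕.1 S hSF
  have hT := h𝓕.1 T hTF
  by_cases hST : S = T
  · subst hST
    simp only [union_sdiff_compl, compl_sdiff_union]
    by_cases hCD : C = D
    · subst hCD
      obtain ⟨E, hE, hEC⟩ := hS.1.exists_disjoint hC.1
      refine ⟨C, E, Or.inl ⟨?_, ?_⟩, isWingOf_cutsOf hSF hC, isWingOf_cutsOf hSF hE⟩
      · rw [inter_self]
        exact hC.1.mono Subset.rfl hC.1.2.1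
      · rw [inter_self]
        exact hE.1.mono (fun x hx => ⟨disjoint_left.1 hEC hx, hE.1.2.1 hx⟩) fun x hx => hx.2
    · have hdisj : Disjoint C D :=
        disjoint_left.2 fun x hx hxD => hCD (hC.1.eq_of_mem hD.1 hx hxD)
      refine ⟨D, C, Or.inr ⟨?_, ?_⟩, isWingOf_cutsOf hSF hD, isWingOf_cutsOf hSF hC⟩
      · exact hD.1.mono (fun x hx => ⟨⟨disjoint_right.1 hdisj hx, hD.1.2.1 hx⟩, hx⟩)
          fun x hx => hx.1.2
      · exact hC.1.mono (fun x hx => ⟨hx, disjoint_left.1 hdisj hx, hC.1.2.1 hx⟩)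
          fun x hx => hx.2.2
  · obtain ⟨i, X, Y, h, hX, hTY, -, -, hi, hi'⟩ := (h𝓕.2 S hSF T hTF).exists_side hS hT hC
    obtain ⟨j, X', Y', h', hX', hSY, -, -, hj, hj'⟩ :=
      (h𝓕.2 T hTF S hSF).exists_side hT hS hD
    obtain ⟨E, hE, hEc⟩ := exists_isEndComp_corner hS hT hST h h' hTY hSY hX
    obtain ⟨F, hF, hFc⟩ := exists_isEndComp_corner hT hS (Ne.symm hST) h' h hSY hTY hX'
    rw [inter_comm] at hFc
    have wE := isWingOf_cutsOf hSF hE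
    have wF := isWingOf_cutsOf hTF hF
    subst hi hi' hj hj'
    cases i <;> cases j
    exacts [⟨F, E, Or.inr ⟨hFc, hEc⟩, wF, wE⟩, ⟨E, F, Or.inl ⟨hEc, hFc⟩, wE, wF⟩,
      ⟨F, E, Or.inl ⟨hFc, hEc⟩, wF, wE⟩, ⟨E, F, Or.inr ⟨hEc, hFc⟩, wE, wF⟩]

lemma isCutSystem_cutsOf {𝓕 : Set (Set V)} (hne : 𝓕.Nonempty) (h𝓕 : IsNestedFamily G 𝓕) :
    IsCutSystem G (cutsOf G 𝓕) := by
  refine ⟨?_, ?_, ?_, ?_, fun c hc c' hc' => exists_opposite_wings h𝓕 hc hc'⟩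
  · obtain ⟨S, hS⟩ := hne
    obtain ⟨-, C, -, hC, -⟩ := (h𝓕.1 S hS).1
    exact ⟨_, S, hS, C, hC, rfl⟩
  · rintro _ ⟨S, hS, C, hC, rfl⟩
    exact (h𝓕.1 S hS).isEssential hC
  · rintro _ ⟨S, hS, C, hC, rfl⟩
    obtain ⟨D, hD, hDC⟩ := (h𝓕.1 S hS).1.exists_disjoint hC.1
    refine ⟨_, ⟨S, hS, D, hD, rfl⟩, union_subset (fun x hx => disjoint_left.1 hDC hx) ?_⟩
    exact fun x hx hxC => hC.1.2.1 hxC hx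
  · rintro _ ⟨S, hS, C, hC, rfl⟩ K hK ⟨_, ⟨T, hT, D, hD, rfl⟩, hDK⟩
    simp only [union_sdiff_compl, compl_sdiff_union] at hK hDK
    have hKS : IsEndComp G S K := ⟨hC.1.of_diff hK, hD.2.mono hDK⟩
    exact ⟨S, hS, K, hKS, (h𝓕.1 S hS).tildeSep_eq hKS⟩

lemma isBasic_cutsOf {𝓕 : Set (Set V)} (hne : 𝓕.Nonempty) (h𝓕 : IsNestedFamily G 𝓕)
    (hinv : ∀ φ : G ≃g G, ∀ S ∈ 𝓕, φ '' S ∈ 𝓕)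
    (htrans : ∀ S ∈ 𝓕, ∀ T ∈ 𝓕, ∃ φ : G ≃g G, φ '' S = T) : IsBasic G (cutsOf G 𝓕) := by
  refine ⟨isCutSystem_cutsOf hne h𝓕, ?_, isNestedSystem_cutsOf h𝓕, ?_, ?_, ?_⟩
  · rintro _ ⟨S, hS, C, hC, rfl⟩ _ ⟨T, hT, D, hD, rfl⟩
    simp only [sepOrder, hC.inter_eq, hD.inter_eq, not_lt]
    exact (h𝓕.1 T hT).2 S (h𝓕.1 S hS).1
  · rintro φ _ ⟨S, hS, C, hC, rfl⟩
    refine ⟨_, hinv φ S hS, _, hC.image φ, ?_⟩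
    rw [image_union, image_compl_eq φ.bijective]
  · rintro _ _ ⟨_, ⟨S, hS, C, hC, rfl⟩, rfl⟩ ⟨_, ⟨T, hT, D, hD, rfl⟩, rfl⟩
    simp only [hC.inter_eq, hD.inter_eq]
    exact htrans S hS T hT
  · rintro _ ⟨S, hS, C, hC, rfl⟩
    obtain ⟨D, hD, hDC⟩ := (h𝓕.1 S hS).1.exists_disjoint hC.1
    refine ⟨hC.2.mono subset_union_left, hD.2.mono fun x hx => disjoint_left.1 hDC hx, ?_⟩
    rintro ⟨d, hd, hfin, hlt, h₁, h₂⟩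
    simp only [sepOrder, hC.inter_eq] at hlt
    exact absurd ((h𝓕.1 S hS).2 _ (hd.isEndSep hfin h₁ h₂)) (not_le.2 hlt)

/-! ### Existence -/

lemma MoreThanOneEnd.exists_isEndSep (h : MoreThanOneEnd G) : ∃ S, IsEndSep G S := by
  obtain ⟨r, r', hr, hr', hne⟩ := h
  simp only [RayEquiv, not_forall] at hne
  obtain ⟨S, hS⟩ := hne
  have eventually : ∀ {q : ℕ → V} {C : Set V} {N : ℕ}, (∀ n, q (N + n) ∈ C) →
      EventuallyIn q C := fun {q C N} hq => ⟨N, fun n hn => by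
    simpa only [Nat.add_sub_cancel' hn] using hq (n - N)⟩
  obtain ⟨C, hC, N, hN⟩ := hr.exists_isCompOf S.finite_toSet
  obtain ⟨D, hD, M, hM⟩ := hr'.exists_isCompOf S.finite_toSet
  refine ⟨S, S.finite_toSet, C, D, ⟨hC, _, hr.tail N, hN⟩, ⟨hD, _, hr'.tail M, hM⟩, ?_⟩
  rintro rfl
  exact hS ⟨C, hC, eventually hN, eventually hM⟩

lemma IsEndSep.exists_isOptimalEndSep {S : Set V} (h : IsEndSep G S) :
    ∃ S, IsOptimalEndSep G S := by
  have hne : {T | IsEndSep G T}.Nonempty := ⟨S, h⟩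
  have hne' : {T | IsMinEndSep G T}.Nonempty :=
    ⟨_, Function.argminOn_mem ncard _ hne, fun R hR => Function.argminOn_le ncard _ hR⟩
  exact ⟨_, Function.argminOn_mem (fun T => (crossingSeps G T).ncard) _ hne',
    fun R hR => Function.argminOn_le (fun T => (crossingSeps G T).ncard) _ hR⟩

end BasicCutSystem

/-- Every connected graph with more than one end admits a basic cut system. -/
theorem stmt_0 {V : Type u} (G : SimpleGraph V) (hconn : G.Connected)
    (hends : MoreThanOneEnd G) :
    ∃ 𝒞 : Set (Set V × Set V), IsBasic G 𝒞 := by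
  obtain ⟨S, hS⟩ := hends.exists_isEndSep
  obtain ⟨S, hS⟩ := hS.exists_isOptimalEndSep
  have hmem : ∀ T ∈ range fun φ : G ≃g G => φ '' S, IsOptimalEndSep G T := by
    rintro _ ⟨φ, rfl⟩
    exact hS.image φ
  refine ⟨cutsOf G (range fun φ : G ≃g G => φ '' S), isBasic_cutsOf ⟨_, RelIso.refl _, rfl⟩
    ⟨fun T hT => (hmem T hT).1, fun R hR T hT => (hmem T hT).sepNested (hmem R hR)⟩ ?_ ?_⟩
  · rintro φ _ ⟨ψ, rfl⟩
    exact ⟨ψ.trans φ, image_comp φ ψ S⟩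
  · rintro _ ⟨φ, rfl⟩ _ ⟨ψ, rfl⟩
    refine ⟨φ.symm.trans ψ, ?_⟩
    change (ψ ∘ φ.symm) '' (φ '' S) = ψ '' S
    rw [image_comp, symm_image_image]
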